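/- Let 0 ≤ t ≤ k ≤ n−k, let U_0 = rowspace[I_k 0_{k×(n−k)}] ⊆ F_q^n, let A ∈ GL_n(F_q), and set U = U_0·A. Then for any k-dimensional subspace V = rowspace(V) of F_q^n (V a rank-k k×n matrix), d_S(V, U) ≤ 2t if and only if the row vector φ(V)·φ̄(A^{−1}) has zero entry at every increasing k-tuple (i_1,…,i_k) that is NOT ≤ (t+1, …, k, n−t+1, …, n) in the Bruhat order; here φ(V) is the row vector of Plücker coordinates of V. -/

import Mathlib

/-- Subspace distance `d_S(U,V) = dim U + dim V - 2 dim (U ∩ V)`. -/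
noncomputable def sDist {F : Type*} [Field F] {n : ℕ}
    (U V : Submodule F (Fin n → F)) : ℕ :=
  Module.finrank F U + Module.finrank F V - 2 * Module.finrank F ↥(U ⊓ V)

/-- Row space of a matrix: the span of its rows. -/
def rowSpace {F : Type*} [Field F] {k n : ℕ} (M : Matrix (Fin k) (Fin n) F) :
    Submodule F (Fin n → F) :=
  Submodule.span F (Set.range fun i : Fin k => M i)

/-- The `k × n` matrix `[I_k  0]`. -/
def idZeroMat (F : Type*) [Field F] (k n : ℕ) : Matrix (Fin k) (Fin n) F :=
  Matrix.of fun i j => if (j : ℕ) = (i : ℕ) then 1 else 0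

/-- The Cauchy–Binet formula. -/
theorem Matrix.det_mul_eq_sum_strictMono {R : Type*} [CommRing R] {k n : ℕ}
    (M : Matrix (Fin k) (Fin n) R) (N : Matrix (Fin n) (Fin k) R) :
    (M * N).det = ∑ I : {f : Fin k → Fin n // StrictMono f},
      (M.submatrix id I.1).det * (N.submatrix I.1 id).det := by
  classical
  have expand : (M * N).det =
      ∑ f : Fin k → Fin n, (∏ i, M i (f i)) * (N.submatrix f id).det := by
    have hrow : M * N = fun i => ∑ j, M i j • N j := by
      ext i c
      simp [Matrix.mul_apply, Finset.sum_apply]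
    rw [hrow]
    change Matrix.detRowAlternating.toMultilinearMap _ = _
    rw [MultilinearMap.map_sum]
    refine Finset.sum_congr rfl fun f _ => ?_
    rw [MultilinearMap.map_smul_univ]
    rfl
  have injective_only :
      ∑ f : Fin k → Fin n, (∏ i, M i (f i)) * (N.submatrix f id).det =
      ∑ f : Fin k → Fin n with Function.Injective f,
        (∏ i, M i (f i)) * (N.submatrix f id).det := by
    refine (Finset.sum_subset (Finset.filter_subset _ _) fun f _ hf => ?_).symm
    rw [Finset.mem_filter_univ] at hf
    simp only [Function.Injective, not_forall] at hf
    obtain ⟨i, j, hij, hne⟩ := hf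
    rw [Matrix.det_zero_of_row_eq hne, mul_zero]
    ext c
    simp [hij]
  have fibre (I : {f : Fin k → Fin n // StrictMono f}) :
      (M.submatrix id I.1).det * (N.submatrix I.1 id).det =
      ∑ σ : Equiv.Perm (Fin k),
        (∏ i, M i (I.1 (σ i))) * (N.submatrix (I.1 ∘ σ) id).det := by
    rw [← Matrix.det_transpose, Matrix.det_apply', Finset.sum_mul]
    refine Finset.sum_congr rfl fun σ _ => ?_
    have hperm : N.submatrix (I.1 ∘ σ) id = (N.submatrix I.1 id).submatrix σ id := rfl
    rw [hperm, Matrix.det_permute]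
    simp only [Matrix.transpose_apply, Matrix.submatrix_apply, id]
    ring
  rw [expand, injective_only, Finset.sum_congr rfl fun I _ => fibre I,
    ← Finset.sum_product']
  symm
  refine Finset.sum_bij (fun p _ => p.1.1 ∘ p.2) ?_ ?_ ?_ ?_
  · intro p _
    simpa using p.1.2.injective.comp p.2.injective
  · rintro ⟨⟨I, hI⟩, σ⟩ _ ⟨⟨I', hI'⟩, σ'⟩ _ h
    have hrange : Set.range I = Set.range I' := by
      have := congrArg Set.range h
      simpa [Set.range_comp] using this
    obtain rfl := (hI.range_inj hI').1 hrange
    have : σ = σ' := Equiv.ext fun i => hI.injective (congrFun h i)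
    rw [this]
  · intro f hf
    have hf : Function.Injective f := by simpa using hf
    refine ⟨⟨⟨f ∘ Tuple.sort f, (Tuple.monotone_sort f).strictMono_of_injective
      (hf.comp (Tuple.sort f).injective)⟩, (Tuple.sort f)⁻¹⟩, by simp, ?_⟩
    ext i
    simp
  · intro p _
    rfl

theorem rowSpace_eq_range_vecMulLinear {F : Type*} [Field F] {k n : ℕ}
    (M : Matrix (Fin k) (Fin n) F) : rowSpace M = LinearMap.range M.vecMulLinear := by
  exact (range_vecMulLinear M).symm

theorem finrank_rowSpace {F : Type*} [Field F] {k n : ℕ} (M : Matrix (Fin k) (Fin n) F) :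
    Module.finrank F (rowSpace M) = M.rank :=
  M.rank_eq_finrank_span_row.symm

theorem rowSpace_mul {F : Type*} [Field F] {k n : ℕ}
    (M : Matrix (Fin k) (Fin n) F) (A : Matrix (Fin n) (Fin n) F) :
    rowSpace (M * A) = (rowSpace M).map A.vecMulLinear := by
  rw [rowSpace_eq_range_vecMulLinear, rowSpace_eq_range_vecMulLinear, ← LinearMap.range_comp]
  congr 1
  refine LinearMap.ext fun x => ?_
  simp [Matrix.vecMul_vecMul]

theorem rowSpace_idZeroMat {F : Type*} [Field F] {k n : ℕ} (hk : k ≤ n) :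
    rowSpace (idZeroMat F k n) =
      LinearMap.ker (LinearMap.funLeft F F (Subtype.val : {j : Fin n // k ≤ (j : ℕ)} → Fin n)) := by
  rw [rowSpace_eq_range_vecMulLinear]
  ext y
  simp only [LinearMap.mem_range, LinearMap.mem_ker, Matrix.vecMulLinear_apply]
  constructor
  · rintro ⟨x, rfl⟩
    ext ⟨j, hj⟩
    simp only [LinearMap.funLeft_apply, Matrix.vecMul, dotProduct, idZeroMat, Matrix.of_apply,
      Pi.zero_apply]
    refine Finset.sum_eq_zero fun i _ => ?_
    rw [if_neg (by omega), mul_zero]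
  · intro hy
    refine ⟨fun i => y (Fin.castLE hk i), ?_⟩
    ext j
    simp only [Matrix.vecMul, dotProduct, idZeroMat, Matrix.of_apply]
    by_cases hj : (j : ℕ) < k
    · rw [Finset.sum_eq_single ⟨j, hj⟩]
      · simp
      · intro i _ hi
        rw [if_neg fun h => hi (Fin.ext h.symm), mul_zero]
      · simp
    · have := congrFun hy ⟨j, not_lt.1 hj⟩
      simp only [LinearMap.funLeft_apply, Pi.zero_apply] at this
      rw [this]
      refine Finset.sum_eq_zero fun i _ => ?_
      rw [if_neg (by omega), mul_zero]

theorem rank_idZeroMat {F : Type*} [Field F] {k n : ℕ} (hk : k ≤ n) :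
    (idZeroMat F k n).rank = k := by
  have h : idZeroMat F k n * (idZeroMat F k n).transpose = 1 := by
    ext i j
    simp only [Matrix.mul_apply, idZeroMat, Matrix.transpose_apply, Matrix.of_apply,
      Matrix.one_apply]
    rw [Finset.sum_eq_single (Fin.castLE hk i)]
    · simp [Fin.ext_iff]
    · intro c _ hc
      rw [if_neg fun h => hc (Fin.ext (by simpa using h)), zero_mul]
    · simp
  refine le_antisymm (by simpa using (idZeroMat F k n).rank_le_card_height) ?_
  have := Matrix.rank_mul_le_left (idZeroMat F k n) (idZeroMat F k n).transpose
  rwa [h, Matrix.rank_one, Fintype.card_fin] at this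

/-- Intersecting the row space of `W` with the coordinate subspace `rowspace [I_k 0]` loses as many
dimensions as the rank of the remaining columns of `W`. -/
theorem finrank_rowSpace_inf_add_rank {F : Type*} [Field F] {k n : ℕ} (hk : k ≤ n)
    (W : Matrix (Fin k) (Fin n) F) :
    Module.finrank F ↥(rowSpace W ⊓ rowSpace (idZeroMat F k n)) +
      (W.submatrix id (Subtype.val : {j : Fin n // k ≤ (j : ℕ)} → Fin n)).rank = W.rank := by
  set P := LinearMap.funLeft F F (Subtype.val : {j : Fin n // k ≤ (j : ℕ)} → Fin n)
  have hrank : (W.submatrix id (Subtype.val : {j : Fin n // k ≤ (j : ℕ)} → Fin n)).rank =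
      Module.finrank F (LinearMap.range (P.domRestrict (rowSpace W))) := by
    rw [Matrix.rank_eq_finrank_span_row, LinearMap.range_domRestrict, rowSpace,
      Submodule.map_span, ← Set.range_comp]
    rfl
  have hker : Module.finrank F ↥(rowSpace W ⊓ rowSpace (idZeroMat F k n)) =
      Module.finrank F (LinearMap.ker (P.domRestrict (rowSpace W))) := by
    rw [rowSpace_idZeroMat hk, LinearMap.ker_domRestrict, ← Submodule.map_comap_subtype,
      Submodule.finrank_map_subtype_eq]
  rw [hrank, hker, add_comm, LinearMap.finrank_range_add_finrank_ker, finrank_rowSpace]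

theorem sDist_le_iff_rank_le {F : Type*} [Field F] {n k t : ℕ} (hk : k ≤ n)
    {A : Matrix (Fin n) (Fin n) F} (hA : IsUnit A)
    {V : Matrix (Fin k) (Fin n) F} (hV : V.rank = k) :
    sDist (rowSpace V) (rowSpace (idZeroMat F k n * A)) ≤ 2 * t ↔
      ((V * A⁻¹).submatrix id (Subtype.val : {j : Fin n // k ≤ (j : ℕ)} → Fin n)).rank ≤ t := by
  have hdet : IsUnit A.det := (Matrix.isUnit_iff_isUnit_det A).1 hA
  have hW : (V * A⁻¹).rank = k := by
    rw [Matrix.rank_mul_eq_left_of_isUnit_det _ _ (A.isUnit_nonsing_inv_det hdet), hV]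
  have hinj : Function.Injective A.vecMulLinear := by
    simpa [Matrix.coe_vecMulLinear] using Matrix.vecMul_injective_iff_isUnit.2 hA
  have hVW : rowSpace V = (rowSpace (V * A⁻¹)).map A.vecMulLinear := by
    rw [← rowSpace_mul, Matrix.nonsing_inv_mul_cancel_right _ _ hdet]
  have hsum := finrank_rowSpace_inf_add_rank hk (V * A⁻¹)
  have hinf : Module.finrank F ↥(rowSpace V ⊓ rowSpace (idZeroMat F k n * A)) =
      Module.finrank F ↥(rowSpace (V * A⁻¹) ⊓ rowSpace (idZeroMat F k n)) := by
    rw [hVW, rowSpace_mul (idZeroMat F k n), ← Submodule.map_inf _ hinj,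
      ← (Submodule.equivMapOfInjective _ hinj _).finrank_eq]
  rw [sDist, finrank_rowSpace, finrank_rowSpace, hinf, hV,
    Matrix.rank_mul_eq_left_of_isUnit_det _ _ hdet, rank_idZeroMat hk]
  omega

/-- An increasing `k`-tuple not below `(t, …, k-1, n-t, …, n-1)` has its last `t + 1` entries
at least `k`. -/
theorem StrictMono.le_apply_of_not_bruhat_le {n k t : ℕ} {J : Fin k → Fin n} (hJ : StrictMono J)
    (h : ¬ ∀ l : Fin k, (J l : ℕ) ≤ if (l : ℕ) < k - t then t + (l : ℕ) else n - k + (l : ℕ)) :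
    t < k ∧ ∀ m : Fin k, k - t - 1 ≤ (m : ℕ) → k ≤ (J m : ℕ) := by
  have growth : ∀ d : ℕ, ∀ a b : Fin k, (b : ℕ) = a + d → (J a : ℕ) + d ≤ J b := by
    intro d
    induction d with
    | zero =>
      intro a b hab
      rw [Fin.ext (by omega : (b : ℕ) = a), Nat.add_zero]
    | succ d ih =>
      intro a b hab
      have h1 := ih a ⟨a + d, by omega⟩ rfl
      have h2 : J ⟨a + d, by omega⟩ < J b := hJ (Fin.lt_def.2 (by simp only; omega))
      have h3 := Fin.lt_def.1 h2
      omega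
  push Not at h
  obtain ⟨l, hl⟩ := h
  split_ifs at hl with hlt
  · refine ⟨by omega, fun m hm => ?_⟩
    have := growth (m - l) l m (by omega)
    omega
  · have h1 := growth (k - 1 - l) l ⟨k - 1, by omega⟩ (by simp only; omega)
    have h2 := (J ⟨k - 1, by omega⟩).isLt
    omega

/-- The columns of index at least `k` of a rank `k` matrix with `k` rows span a space of dimension
at most `t` iff all maximal minors not Bruhat-below `(t, …, k-1, n-t, …, n-1)` vanish. -/
theorem rank_submatrix_le_iff_minors {F : Type*} [Field F] {n k t : ℕ} (ht : t ≤ k)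
    {W : Matrix (Fin k) (Fin n) F} (hW : W.rank = k) :
    (W.submatrix id (Subtype.val : {j : Fin n // k ≤ (j : ℕ)} → Fin n)).rank ≤ t ↔
    ∀ J : {f : Fin k → Fin n // StrictMono f},
      ¬ (∀ l : Fin k, (J.1 l : ℕ) ≤
          (if (l : ℕ) < k - t then t + (l : ℕ) else n - k + (l : ℕ))) →
      (W.submatrix id J.1).det = 0 := by
  classical
  have hspan : (W.submatrix id (Subtype.val : {j : Fin n // k ≤ (j : ℕ)} → Fin n)).rank =
      Module.finrank F (Submodule.span F (W.col '' {j | k ≤ (j : ℕ)})) := by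
    rw [Matrix.rank_eq_finrank_span_cols, Set.image_eq_range]
    rfl
  rw [hspan]
  constructor
  · intro hr J hJ
    obtain ⟨htk, hlast⟩ := J.2.le_apply_of_not_bruhat_le hJ
    by_contra hdet
    have hli : LinearIndependent F (W.submatrix id J.1).col :=
      Matrix.linearIndependent_cols_iff_isUnit.2
        ((Matrix.isUnit_iff_isUnit_det _).2 (isUnit_iff_ne_zero.2 hdet))
    let e : Fin (t + 1) → Fin k := fun i => ⟨k - t - 1 + i, by omega⟩
    have he : Function.Injective e := fun i j hij => by
      have := congrArg Fin.val hij
      simp only [e] at this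
      exact Fin.ext (by omega)
    have hcard := finrank_span_eq_card (hli.comp e he)
    have hle : Submodule.span F (Set.range ((W.submatrix id J.1).col ∘ e)) ≤
        Submodule.span F (W.col '' {j | k ≤ (j : ℕ)}) := by
      refine Submodule.span_mono ?_
      rintro _ ⟨i, rfl⟩
      exact ⟨J.1 (e i), hlast _ (by simp [e]), rfl⟩
    have := Submodule.finrank_mono hle
    rw [hcard, Fintype.card_fin] at this
    omega
  · intro h
    by_contra! hr
    obtain ⟨s, hs, -, hspan_s, hli_s⟩ := exists_linearIndepOn_extension
      (linearIndepOn_empty F W.col) (Set.empty_subset {j : Fin n | k ≤ (j : ℕ)})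
    obtain ⟨b, -, hsb, hspan_b, hli_b⟩ := exists_linearIndepOn_extension
      hli_s (Set.subset_univ s)
    have hfin {c : Set (Fin n)} (hc : LinearIndepOn F W.col c) :
        Module.finrank F (Submodule.span F (W.col '' c)) = c.toFinset.card := by
      rw [Set.image_eq_range, finrank_span_eq_card hc, Set.toFinset_card]
    have hscard : t < s.toFinset.card := by
      rw [← hfin hli_s]
      exact hr.trans_le (Submodule.finrank_mono (Submodule.span_le.2 hspan_s))
    have hbcard : b.toFinset.card = k := by
      rw [← hfin hli_b]
      refine Eq.trans ?_ hW
      rw [Matrix.rank_eq_finrank_span_cols, ← Set.image_univ]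
      exact le_antisymm (Submodule.finrank_mono (Submodule.span_mono (Set.image_mono
        (Set.subset_univ b)))) (Submodule.finrank_mono (Submodule.span_le.2 hspan_b))
    let J := b.toFinset.orderEmbOfFin hbcard
    have hJb (i : Fin k) : J i ∈ b :=
      Set.mem_toFinset.1 (b.toFinset.orderEmbOfFin_mem hbcard i)
    have hli : LinearIndependent F (W.submatrix id J).col :=
      LinearIndependent.comp hli_b (fun i : Fin k => (⟨J i, hJb i⟩ : b)) fun i j hij =>
        J.injective (Subtype.mk.inj hij)
    refine ((Matrix.isUnit_iff_isUnit_det _).1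
      (Matrix.linearIndependent_cols_iff_isUnit.1 hli)).ne_zero
      (h ⟨J, J.strictMono⟩ fun hle => ?_)
    have hsub : s.toFinset ⊆ ({l : Fin k | k - t ≤ (l : ℕ)} : Finset (Fin k)).image J := by
      intro j hj
      have hjs : j ∈ s := by simpa using hj
      have hj' : j ∈ Set.range J := by
        rw [Finset.range_orderEmbOfFin]
        simpa using hsb hjs
      obtain ⟨l, rfl⟩ := hj'
      refine Finset.mem_image_of_mem _ ?_
      rw [Finset.mem_filter_univ]
      by_contra! hlt
      have h1 := hle l
      have h2 : k ≤ (J l : ℕ) := hs hjs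
      simp only [if_pos hlt] at h1
      omega
    have hlast : ({l : Fin k | k - t ≤ (l : ℕ)} : Finset (Fin k)).card ≤ t := by
      calc _ ≤ (Finset.Ico (k - t) k).card :=
            Finset.card_le_card_of_injOn Fin.val (fun l hl => by simpa using hl)
              Fin.val_injective.injOn
        _ = t := by rw [Nat.card_Ico]; omega
    have := (Finset.card_le_card hsub).trans Finset.card_image_le
    omega

/-- Theorem 5 of the paper: let `U = U_0 · A` with
`U_0 = rowspace [I_k 0]` and `A ∈ GL_n(F_q)`.  Then a `k`-dimensional subspace
`rowspace V` lies in the ball `B_{2t}(U)` iff the row vector `φ(V)·φ̄(A⁻¹)` vanishes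
at every increasing `k`-tuple that is not `≤ (t+1,…,k,n−t+1,…,n)` in the Bruhat order
(`0`-indexed: reference tuple `t,…,k−1,n−t,…,n−1`). -/
theorem ball_around_subspace_in_pluecker
    {F : Type*} [Field F] [Fintype F] {n k t : ℕ} (ht : t ≤ k) (hk : k ≤ n - k)
    (A : Matrix (Fin n) (Fin n) F) (hA : IsUnit A)
    (V : Matrix (Fin k) (Fin n) F) (hV : V.rank = k) :
    sDist (rowSpace V) (rowSpace (idZeroMat F k n * A)) ≤ 2 * t ↔
    ∀ J : {f : Fin k → Fin n // StrictMono f},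
      ¬ (∀ l : Fin k, (J.1 l : ℕ) ≤
          (if (l : ℕ) < k - t then t + (l : ℕ) else n - k + (l : ℕ))) →
      ∑ I : {f : Fin k → Fin n // StrictMono f},
        (V.submatrix id I.1).det * ((A⁻¹).submatrix I.1 J.1).det = 0 := by
  have hdet : IsUnit A.det := (Matrix.isUnit_iff_isUnit_det A).1 hA
  have hW : (V * A⁻¹).rank = k := by
    rw [Matrix.rank_mul_eq_left_of_isUnit_det _ _ (A.isUnit_nonsing_inv_det hdet), hV]
  rw [sDist_le_iff_rank_le (by omega) hA hV, rank_submatrix_le_iff_minors ht hW]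
  refine forall_congr' fun J => imp_congr_right fun _ => ?_
  have hminor : (V * A⁻¹).submatrix id J.1 = V * A⁻¹.submatrix id J.1 := rfl
  rw [hminor, Matrix.det_mul_eq_sum_strictMono]
  rfl
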